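/- arXiv:2101.03390 — 2 statements merged into one kernel-verified Lean document; each statement's English description precedes it below -/
import Mathlib

section
/- There exists a constant C > 0 such that for every natural number p and every continuously differentiable function u : ℝ → ℝ on [-1, 1], there is a real polynomial q of degree at most p with ‖u - q‖_{L²(-1,1)} ≤ (C/(p+1)) ‖u'‖_{L²(-1,1)}. In particular the L²(-1,1)-distance from u to the space of polynomials of degree at most p is at most (C/(p+1)) ‖u'‖_{L²(-1,1)}. -/
open Polynomial

/-- Integration of polynomials over `[-1, 1]`, as a linear functional. -/
noncomputable def referenceIntegral : ℝ[X] →ₗ[ℝ] ℝ where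
  toFun f := ∫ x in (-1 : ℝ)..1, f.eval x
  map_add' f g := by
    simp only [eval_add]
    exact intervalIntegral.integral_add (f.continuous.intervalIntegrable _ _)
      (g.continuous.intervalIntegrable _ _)
  map_smul' c f := by simp

theorem referenceIntegral_apply (f : ℝ[X]) :
    referenceIntegral f = ∫ x in (-1 : ℝ)..1, f.eval x := rfl

theorem referenceIntegral_derivative (f : ℝ[X]) :
    referenceIntegral (derivative f) = f.eval 1 - f.eval (-1) :=
  intervalIntegral.integral_eq_sub_of_hasDerivAt (fun x _ => f.hasDerivAt x)
    ((derivative f).continuous.intervalIntegrable _ _)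

theorem referenceIntegral_C_mul (c : ℝ) (f : ℝ[X]) :
    referenceIntegral (C c * f) = c * referenceIntegral f := by
  rw [← smul_eq_C_mul, map_smul, smul_eq_mul]

theorem referenceIntegral_sq_nonneg (f : ℝ[X]) : 0 ≤ referenceIntegral (f ^ 2) := by
  rw [referenceIntegral_apply]
  exact intervalIntegral.integral_nonneg (by norm_num) fun x _ => by
    rw [eval_pow]; positivity

theorem referenceIntegral_weight_mul_sq_le (f : ℝ[X]) :
    referenceIntegral ((1 - X ^ 2) * f ^ 2) ≤ referenceIntegral (f ^ 2) := by
  have h := referenceIntegral_sq_nonneg (X * f)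
  have e : (1 - X ^ 2) * f ^ 2 = f ^ 2 - (X * f) ^ 2 := by ring
  rw [e, map_sub]
  linarith

/-- The Legendre polynomial of degree `n`, up to normalization, by the Rodrigues formula. -/
noncomputable def rodriguesLegendre (n : ℕ) : ℝ[X] := derivative^[n] ((X ^ 2 - 1) ^ n)

theorem iterate_derivative_X_sq_sub_one_pow (n k : ℕ) :
    (X ^ 2 - 1) * derivative^[k + 2] ((X ^ 2 - 1 : ℝ[X]) ^ n) =
      C (2 * n - 2 * (k + 1) : ℝ) * X * derivative^[k + 1] ((X ^ 2 - 1) ^ n) +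
        C ((k + 1) * (2 * n - k) : ℝ) * derivative^[k] ((X ^ 2 - 1) ^ n) := by
  set w : ℝ[X] := (X ^ 2 - 1) ^ n with hw
  induction k with
  | zero =>
    have h : (X ^ 2 - 1) * derivative w = C (2 * n : ℝ) * X * w := by
      rcases n with _ | n
      · simp [hw]
      · rw [hw, derivative_pow]
        simp [C_ofNat]
        ring
    have hder := congrArg derivative h
    simp only [derivative_mul, derivative_sub, derivative_one, derivative_C, derivative_X,
      derivative_X_pow] at hder
    simp only [Function.iterate_succ_apply', Function.iterate_zero_apply]
    simp [C_ofNat] at hder ⊢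
    linear_combination hder
  | succ k ih =>
    have hder := congrArg derivative ih
    simp only [derivative_mul, derivative_add, derivative_sub, derivative_one, derivative_C,
      derivative_X, derivative_X_pow, ← Function.iterate_succ_apply' derivative] at hder
    simp [C_ofNat] at hder ⊢
    linear_combination hder

/-- The Legendre differential equation in divergence form. -/
theorem derivative_weight_mul_derivative_rodriguesLegendre (n : ℕ) :
    derivative ((1 - X ^ 2) * derivative (rodriguesLegendre n)) =
      -(C (n * (n + 1) : ℝ) * rodriguesLegendre n) := by
  have h := iterate_derivative_X_sq_sub_one_pow n n
  simp only [derivative_mul, derivative_sub, derivative_one, derivative_X_pow]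
  simp only [rodriguesLegendre, ← Function.iterate_succ_apply' derivative]
  simp [C_ofNat] at h ⊢
  linear_combination -h

theorem natDegree_X_sq_sub_one_pow (n : ℕ) : ((X ^ 2 - 1 : ℝ[X]) ^ n).natDegree = 2 * n := by
  rw [natDegree_pow, ← C_1, natDegree_X_pow_sub_C, mul_comm]

theorem natDegree_rodriguesLegendre_le (n : ℕ) : (rodriguesLegendre n).natDegree ≤ n := by
  refine (natDegree_iterate_derivative _ n).trans ?_
  rw [natDegree_X_sq_sub_one_pow]
  omega

theorem coeff_rodriguesLegendre_ne_zero (n : ℕ) : (rodriguesLegendre n).coeff n ≠ 0 := by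
  have hm : ((X ^ 2 - 1 : ℝ[X]) ^ n).Monic := by
    rw [← C_1]
    exact (monic_X_pow_sub_C _ two_ne_zero).pow n
  have hc : ((X ^ 2 - 1 : ℝ[X]) ^ n).coeff (n + n) = 1 := by
    rw [← two_mul, ← natDegree_X_sq_sub_one_pow n]
    exact hm
  rw [rodriguesLegendre, coeff_iterate_derivative, hc, nsmul_eq_mul, mul_one, Nat.cast_ne_zero,
    Ne, Nat.descFactorial_eq_zero_iff_lt]
  omega

theorem exists_eq_C_mul_rodriguesLegendre_add {n : ℕ} {f : ℝ[X]} (hf : f.degree < (n + 1 : ℕ)) :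
    ∃ (c : ℝ) (g : ℝ[X]), g.degree < n ∧ f = C c * rodriguesLegendre n + g := by
  refine ⟨f.coeff n / (rodriguesLegendre n).coeff n,
    f - C (f.coeff n / (rodriguesLegendre n).coeff n) * rodriguesLegendre n, ?_, by ring⟩
  rw [degree_lt_iff_coeff_zero] at hf ⊢
  intro m hm
  rw [coeff_sub, coeff_C_mul]
  rcases hm.eq_or_lt with rfl | hm
  · rw [div_mul_cancel₀ _ (coeff_rodriguesLegendre_ne_zero _), sub_self]
  · rw [hf m hm, coeff_eq_zero_of_natDegree_lt ((natDegree_rodriguesLegendre_le n).trans_lt hm)]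
    simp

theorem referenceIntegral_weight_mul_derivative_rodriguesLegendre (n : ℕ) (g : ℝ[X]) :
    referenceIntegral ((1 - X ^ 2) * (derivative (rodriguesLegendre n) * derivative g)) =
      n * (n + 1) * referenceIntegral (rodriguesLegendre n * g) := by
  have h := referenceIntegral_derivative ((1 - X ^ 2) * derivative (rodriguesLegendre n) * g)
  rw [derivative_mul, derivative_weight_mul_derivative_rodriguesLegendre, map_add, neg_mul,
    map_neg, mul_assoc (C _), referenceIntegral_C_mul] at h
  simp only [eval_mul, eval_sub, eval_one, eval_pow, eval_X] at h
  rw [← mul_assoc]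
  linarith

theorem referenceIntegral_rodriguesLegendre_mul_eq_zero_of_ne {m n : ℕ} (h : m ≠ n) :
    referenceIntegral (rodriguesLegendre n * rodriguesLegendre m) = 0 := by
  have h₁ := referenceIntegral_weight_mul_derivative_rodriguesLegendre n (rodriguesLegendre m)
  have h₂ := referenceIntegral_weight_mul_derivative_rodriguesLegendre m (rodriguesLegendre n)
  rw [mul_comm (derivative _), h₁, mul_comm (rodriguesLegendre m)] at h₂
  have h₃ : ((n : ℝ) - m) * (n + m + 1) *
      referenceIntegral (rodriguesLegendre n * rodriguesLegendre m) = 0 := by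
    linear_combination h₂
  have h₄ : (n : ℝ) - m ≠ 0 := sub_ne_zero.2 (Nat.cast_injective.ne h.symm)
  have h₅ : (n : ℝ) + m + 1 ≠ 0 := by positivity
  simpa [h₄, h₅] using h₃

theorem referenceIntegral_rodriguesLegendre_mul_of_degree_lt {n : ℕ} {g : ℝ[X]}
    (hg : g.degree < n) : referenceIntegral (rodriguesLegendre n * g) = 0 := by
  have key : ∀ m ≤ n, ∀ g : ℝ[X], g.degree < m →
      referenceIntegral (rodriguesLegendre n * g) = 0 := by
    intro m
    induction m with
    | zero =>
      intro _ g hg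
      have : g = 0 := by simpa using hg
      simp [this]
    | succ m ih =>
      intro hm g hg
      obtain ⟨c, g, hg', rfl⟩ := exists_eq_C_mul_rodriguesLegendre_add hg
      rw [mul_add, map_add, ih (by omega) g hg', mul_left_comm, referenceIntegral_C_mul,
        referenceIntegral_rodriguesLegendre_mul_eq_zero_of_ne (by omega)]
      simp
  exact key n le_rfl g hg

/-- The approximation estimate for polynomials, with the weight `1 - x ^ 2` on the derivative. -/
theorem exists_referenceIntegral_sub_sq_le (p N : ℕ) {f : ℝ[X]} (hf : f.degree < N) :
    ∃ q : ℝ[X], q.natDegree ≤ p ∧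
      ((p : ℝ) + 1) ^ 2 * referenceIntegral ((f - q) ^ 2) ≤
        referenceIntegral ((1 - X ^ 2) * derivative f ^ 2) := by
  induction N generalizing f with
  | zero =>
    have : f = 0 := by simpa using hf
    exact ⟨0, by simp, by simp [this]⟩
  | succ N ih =>
    obtain ⟨c, g, hg, rfl⟩ := exists_eq_C_mul_rodriguesLegendre_add hf
    have horth := referenceIntegral_rodriguesLegendre_mul_of_degree_lt hg
    have hself := referenceIntegral_weight_mul_derivative_rodriguesLegendre N
      (rodriguesLegendre N)
    have hcross := referenceIntegral_weight_mul_derivative_rodriguesLegendre N g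
    rw [horth, mul_zero] at hcross
    obtain ⟨q, hq, hqg⟩ := ih hg
    have henergy : referenceIntegral
        ((1 - X ^ 2) * derivative (C c * rodriguesLegendre N + g) ^ 2) =
        c ^ 2 * (N * (N + 1) * referenceIntegral (rodriguesLegendre N ^ 2)) +
          referenceIntegral ((1 - X ^ 2) * derivative g ^ 2) := by
      have e : (1 - X ^ 2) * derivative (C c * rodriguesLegendre N + g) ^ 2 =
          C (c ^ 2) * ((1 - X ^ 2) *
            (derivative (rodriguesLegendre N) * derivative (rodriguesLegendre N))) +
          C (2 * c) * ((1 - X ^ 2) * (derivative (rodriguesLegendre N) * derivative g)) +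
          (1 - X ^ 2) * derivative g ^ 2 := by
        simp only [derivative_add, derivative_C_mul, C_mul, C_pow, C_ofNat]
        ring
      rw [e, map_add, map_add, referenceIntegral_C_mul, referenceIntegral_C_mul, hself, hcross,
        sq (rodriguesLegendre N)]
      ring
    have hnn := mul_nonneg (sq_nonneg c) (referenceIntegral_sq_nonneg (rodriguesLegendre N))
    rcases le_or_gt N p with hNp | hpN
    · refine ⟨C c * rodriguesLegendre N + g, ?_, ?_⟩
      · exact natDegree_le_of_degree_le
          ((degree_le_of_natDegree_le (Nat.lt_succ_iff.1 (by
            by_cases h0 : C c * rodriguesLegendre N + g = 0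
            · simp [h0]
            · exact (natDegree_lt_iff_degree_lt h0).2 hf))).trans (by exact_mod_cast hNp))
      · rw [henergy, sub_self, zero_pow two_ne_zero, map_zero, mul_zero]
        have hp : (0 : ℝ) ≤ ((p : ℝ) + 1) ^ 2 * referenceIntegral ((g - q) ^ 2) :=
          mul_nonneg (by positivity) (referenceIntegral_sq_nonneg _)
        have hN : (0 : ℝ) ≤ N * (N + 1) := by positivity
        nlinarith [mul_nonneg hN hnn]
    · refine ⟨q, hq, ?_⟩
      have hqN : q.degree < N := degree_le_natDegree.trans_lt (by exact_mod_cast hq.trans_lt hpN)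
      have hgq := referenceIntegral_rodriguesLegendre_mul_of_degree_lt
        ((degree_sub_le g q).trans_lt (max_lt hg hqN))
      have e : (C c * rodriguesLegendre N + g - q) ^ 2 =
          C (c ^ 2) * rodriguesLegendre N ^ 2 + C (2 * c) * (rodriguesLegendre N * (g - q)) +
            (g - q) ^ 2 := by
        simp only [C_mul, C_pow, C_ofNat]
        ring
      rw [henergy, e, map_add, map_add, referenceIntegral_C_mul, referenceIntegral_C_mul, hgq]
      have hN : ((p : ℝ) + 1) ^ 2 ≤ N * (N + 1) := by
        have : (p : ℝ) + 1 ≤ N := by exact_mod_cast hpN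
        have : (0 : ℝ) ≤ p := by positivity
        nlinarith
      nlinarith [mul_le_mul_of_nonneg_right hN hnn]

theorem Polynomial.exists_derivative_eq_and_eval_eq (f : ℝ[X]) (a b : ℝ) :
    ∃ F : ℝ[X], derivative F = f ∧ F.eval a = b := by
  have h : ∃ F : ℝ[X], derivative F = f := by
    induction f using Polynomial.induction_on' with
    | add f g hf hg =>
      obtain ⟨F, rfl⟩ := hf
      obtain ⟨G, rfl⟩ := hg
      exact ⟨F + G, derivative_add⟩
    | monomial n c =>
      refine ⟨monomial (n + 1) (c / (n + 1)), ?_⟩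
      rw [derivative_monomial]
      have : (n : ℝ) + 1 ≠ 0 := by positivity
      simp [this]
  obtain ⟨F, rfl⟩ := h
  exact ⟨F + C (b - F.eval a), by simp, by simp⟩

/-- A function with continuous derivative is `C¹`-close to polynomials on `[-1, 1]`. -/
theorem exists_polynomial_near_with_derivative {u : ℝ → ℝ}
    (hu : ContDiffOn ℝ 1 u (Set.Icc (-1 : ℝ) 1)) {ε : ℝ} (hε : 0 < ε) :
    ∃ F : ℝ[X], ∀ x ∈ Set.Icc (-1 : ℝ) 1, |u x - F.eval x| ≤ 2 * ε ∧
      |(derivative F).eval x - derivWithin u (Set.Icc (-1 : ℝ) 1) x| ≤ ε := by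
  obtain ⟨P, hP⟩ := exists_polynomial_near_of_continuousOn (-1) 1 _
    (hu.continuousOn_derivWithin (uniqueDiffOn_Icc (by norm_num)) le_rfl) ε hε
  obtain ⟨F, rfl, hF⟩ := P.exists_derivative_eq_and_eval_eq (-1) (u (-1))
  refine ⟨F, fun x hx => ⟨?_, (hP x hx).le⟩⟩
  have hmem : (-1 : ℝ) ∈ Set.Icc (-1 : ℝ) 1 := by simp
  have h := (convex_Icc (-1 : ℝ) 1).norm_image_sub_le_of_norm_hasDerivWithin_le
    (f := fun y => u y - F.eval y)
    (f' := fun y => derivWithin u (Set.Icc (-1 : ℝ) 1) y - (derivative F).eval y) (C := ε)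
    (fun y hy => ((hu.differentiableOn one_ne_zero y hy).hasDerivWithinAt).sub
      (F.hasDerivAt y).hasDerivWithinAt)
    (fun y hy => by rw [Real.norm_eq_abs, abs_sub_comm]; exact (hP y hy).le) hmem hx
  simp only [hF, sub_self, sub_zero, Real.norm_eq_abs] at h
  refine h.trans ?_
  rw [mul_comm]
  refine mul_le_mul_of_nonneg_right ?_ hε.le
  rw [abs_le]
  constructor <;> linarith [hx.1, hx.2]

theorem integral_sq_le_of_abs_sub_le {f g : ℝ → ℝ} (hf : ContinuousOn f (Set.Icc (-1 : ℝ) 1))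
    (hg : ContinuousOn g (Set.Icc (-1 : ℝ) 1)) {δ : ℝ}
    (h : ∀ x ∈ Set.Icc (-1 : ℝ) 1, |f x - g x| ≤ δ) :
    ∫ x in (-1 : ℝ)..1, f x ^ 2 ≤ 4 * δ ^ 2 + 2 * ∫ x in (-1 : ℝ)..1, g x ^ 2 := by
  have hle : (-1 : ℝ) ≤ 1 := by norm_num
  have hfi := (hf.pow 2).intervalIntegrable_of_Icc (μ := MeasureTheory.volume) hle
  have hgi : IntervalIntegrable (fun x => g x ^ 2) MeasureTheory.volume (-1) 1 :=
    (hg.pow 2).intervalIntegrable_of_Icc hle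
  calc ∫ x in (-1 : ℝ)..1, f x ^ 2
      ≤ ∫ x in (-1 : ℝ)..1, (2 * δ ^ 2 + 2 * g x ^ 2) := by
        refine intervalIntegral.integral_mono_on hle hfi
          (intervalIntegrable_const.add (hgi.const_mul 2)) fun x hx => ?_
        have := sq_le_sq' (abs_le.1 (h x hx)).1 (abs_le.1 (h x hx)).2
        nlinarith [sq_nonneg (f x - 2 * g x)]
    _ = 4 * δ ^ 2 + 2 * ∫ x in (-1 : ℝ)..1, g x ^ 2 := by
        rw [intervalIntegral.integral_add intervalIntegrable_const (hgi.const_mul 2),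
          intervalIntegral.integral_const, intervalIntegral.integral_const_mul, smul_eq_mul]
        ring

theorem exists_polynomial_integral_sub_sq_le (p : ℕ) {u : ℝ → ℝ}
    (hu : ContDiffOn ℝ 1 u (Set.Icc (-1 : ℝ) 1)) {ε : ℝ} (hε : 0 < ε) :
    ∃ q : ℝ[X], q.natDegree ≤ p ∧
      ∫ x in (-1 : ℝ)..1, (u x - q.eval x) ^ 2 ≤ 24 * ε ^ 2 + 4 / ((p : ℝ) + 1) ^ 2 *
        ∫ x in (-1 : ℝ)..1, (derivWithin u (Set.Icc (-1 : ℝ) 1) x) ^ 2 := by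
  obtain ⟨F, hF⟩ := exists_polynomial_near_with_derivative hu hε
  obtain ⟨q, hq, hFq⟩ := exists_referenceIntegral_sub_sq_le p (F.natDegree + 1) (f := F)
    (degree_le_natDegree.trans_lt (by exact_mod_cast Nat.lt_succ_self _))
  refine ⟨q, hq, ?_⟩
  have h₁ := integral_sq_le_of_abs_sub_le (f := fun x => u x - q.eval x)
    (g := fun x => (F - q).eval x) (hu.continuousOn.sub q.continuous.continuousOn)
    (F - q).continuous.continuousOn (δ := 2 * ε) fun x hx => by
      simpa using (hF x hx).1
  have h₂ := integral_sq_le_of_abs_sub_le (derivative F).continuous.continuousOn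
    (hu.continuousOn_derivWithin (uniqueDiffOn_Icc (by norm_num)) le_rfl)
    fun x hx => (hF x hx).2
  have h₃ := hFq.trans (referenceIntegral_weight_mul_sq_le _)
  simp only [referenceIntegral_apply, eval_pow] at h₃
  set J := ∫ x in (-1 : ℝ)..1, (derivWithin u (Set.Icc (-1 : ℝ) 1) x) ^ 2
  set K := ∫ x in (-1 : ℝ)..1, (F - q).eval x ^ 2
  have hp : (1 : ℝ) ≤ ((p : ℝ) + 1) ^ 2 := by
    have : (0 : ℝ) ≤ p := by positivity
    nlinarith
  have hK : K ≤ 4 * ε ^ 2 + 2 / ((p : ℝ) + 1) ^ 2 * J := by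
    have : K ≤ (4 * ε ^ 2 + 2 * J) / ((p : ℝ) + 1) ^ 2 := by
      rw [le_div_iff₀ (by positivity), mul_comm]
      exact h₃.trans h₂
    have h₄ : 4 * ε ^ 2 / ((p : ℝ) + 1) ^ 2 ≤ 4 * ε ^ 2 := div_le_self (by positivity) hp
    calc K ≤ _ := this
      _ = 4 * ε ^ 2 / ((p : ℝ) + 1) ^ 2 + 2 / ((p : ℝ) + 1) ^ 2 * J := by ring
      _ ≤ _ := by linarith
  calc _ ≤ _ := h₁
    _ ≤ 4 * (2 * ε) ^ 2 + 2 * (4 * ε ^ 2 + 2 / ((p : ℝ) + 1) ^ 2 * J) := by gcongr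
    _ = _ := by ring


/-- One-dimensional hp-approximation estimate on the reference interval:
there is a constant `C > 0` such that for every `p` and every `u` continuously
differentiable on `[-1, 1]`, some polynomial `q` of degree at most `p`
satisfies `‖u - q‖_{L²(-1,1)} ≤ (C/(p+1)) ‖u'‖_{L²(-1,1)}`. -/
theorem hp_approximation_reference_interval :
    ∃ C : ℝ, 0 < C ∧ ∀ (p : ℕ) (u : ℝ → ℝ),
      ContDiffOn ℝ 1 u (Set.Icc (-1 : ℝ) 1) →
      ∃ q : Polynomial ℝ, q.natDegree ≤ p ∧
        Real.sqrt (∫ x in (-1 : ℝ)..1, (u x - q.eval x) ^ 2) ≤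
          C / ((p : ℝ) + 1) *
            Real.sqrt
              (∫ x in (-1 : ℝ)..1, (derivWithin u (Set.Icc (-1 : ℝ) 1) x) ^ 2) := by
  refine ⟨3, by norm_num, fun p u hu => ?_⟩
  set v := derivWithin u (Set.Icc (-1 : ℝ) 1) with hv
  have hvc : ContinuousOn v (Set.Icc (-1 : ℝ) 1) :=
    hu.continuousOn_derivWithin (uniqueDiffOn_Icc (by norm_num)) le_rfl
  have hJ : 0 ≤ ∫ x in (-1 : ℝ)..1, v x ^ 2 :=
    intervalIntegral.integral_nonneg (by norm_num) fun x _ => sq_nonneg _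
  rcases hJ.eq_or_lt with hJ | hJ
  · have hzero : ∀ x ∈ Set.Icc (-1 : ℝ) 1, v x = 0 := by
      intro x hx
      by_contra hne
      exact hJ.not_lt (intervalIntegral.integral_pos (by norm_num) (hvc.pow 2)
        (fun y _ => sq_nonneg _) ⟨x, hx, by positivity⟩)
    have hconst := constant_of_derivWithin_zero (hu.differentiableOn one_ne_zero)
      fun x hx => hzero x (Set.Ico_subset_Icc_self hx)
    refine ⟨Polynomial.C (u (-1)), by simp, ?_⟩
    have : ∫ x in (-1 : ℝ)..1, (u x - (Polynomial.C (u (-1))).eval x) ^ 2 = 0 := by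
      rw [intervalIntegral.integral_congr (g := fun _ => 0), intervalIntegral.integral_zero]
      intro x hx
      rw [Set.uIcc_of_le (by norm_num)] at hx
      simp [hconst x hx]
    rw [this, Real.sqrt_zero]
    positivity
  · set J := ∫ x in (-1 : ℝ)..1, v x ^ 2
    obtain ⟨q, hq, h⟩ := exists_polynomial_integral_sub_sq_le p hu
      (ε := Real.sqrt J / (5 * ((p : ℝ) + 1))) (by positivity)
    refine ⟨q, hq, Real.sqrt_le_iff.2 ⟨by positivity, h.trans ?_⟩⟩
    rw [mul_pow, div_pow, div_pow, Real.sq_sqrt hJ.le, mul_pow]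
    have e : 24 * (J / (5 ^ 2 * ((p : ℝ) + 1) ^ 2)) + 4 / ((p : ℝ) + 1) ^ 2 * J =
        (24 / 25 + 4) * (J / ((p : ℝ) + 1) ^ 2) := by
      field_simp
      norm_num
    have h₀ : 0 ≤ J / ((p : ℝ) + 1) ^ 2 := by positivity
    calc _ = (24 / 25 + 4) * (J / ((p : ℝ) + 1) ^ 2) := e
      _ ≤ 3 ^ 2 * (J / ((p : ℝ) + 1) ^ 2) := by gcongr; norm_num
      _ = _ := by ring
end

section
/- There exists a constant C > 0 such that for every natural number p, every interval (a, b) with a < b and h = b - a, and every continuously differentiable function u : ℝ → ℝ on [a, b], there is a real polynomial q of degree at most p with ‖u - q‖_{L²(a,b)} ≤ (C h/(p+1)) ‖u'‖_{L²(a,b)}; the constant C is independent of p, u, a, and b. -/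
open Polynomial

/-- Integration over `a..b` as a linear functional on real polynomials. -/
noncomputable def polyIntegral (a b : ℝ) : ℝ[X] →ₗ[ℝ] ℝ where
  toFun f := ∫ x in a..b, f.eval x
  map_add' f g := by
    simp only [eval_add]
    exact intervalIntegral.integral_add (f.continuous.intervalIntegrable a b)
      (g.continuous.intervalIntegrable a b)
  map_smul' c f := by
    simp [eval_smul]

lemma polyIntegral_apply (a b : ℝ) (f : ℝ[X]) :
    polyIntegral a b f = ∫ x in a..b, f.eval x := rfl

lemma polyIntegral_derivative (a b : ℝ) (f : ℝ[X]) :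
    polyIntegral a b (derivative f) = f.eval b - f.eval a :=
  intervalIntegral.integral_eq_sub_of_hasDerivAt (fun x _ => f.hasDerivAt x)
    ((derivative f).continuous.intervalIntegrable a b)

lemma polyIntegral_sq_pos {a b : ℝ} (hab : a < b) {f : ℝ[X]} (hf : f ≠ 0) :
    0 < polyIntegral a b (f * f) := by
  rw [polyIntegral_apply]
  obtain ⟨c, hc, hc0⟩ : ∃ c ∈ Set.Icc a b, f.eval c ≠ 0 := by
    by_contra! h
    exact hf (f.eq_zero_of_infinite_isRoot ((Set.Icc_infinite hab).mono h))
  refine intervalIntegral.integral_pos hab (f * f).continuous.continuousOn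
    (fun x _ => ?_) ⟨c, hc, ?_⟩
  · rw [eval_mul]
    exact mul_self_nonneg _
  · rw [eval_mul]
    exact mul_self_pos.2 hc0

/-- The weight `(x - a)(b - x)` vanishing at both end points. -/
noncomputable def legendreWeight (a b : ℝ) : ℝ[X] := (X - C a) * (C b - X)

/-- The Legendre differential operator `f ↦ (w f')'` on the interval `(a, b)`. -/
noncomputable def legendreOp (a b : ℝ) (f : ℝ[X]) : ℝ[X] :=
  derivative (legendreWeight a b * derivative f)

lemma coeff_legendreOp (a b : ℝ) (f : ℝ[X]) (k : ℕ) :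
    (legendreOp a b f).coeff k = -(k * (k + 1)) * f.coeff k
      + (a + b) * (k + 1) ^ 2 * f.coeff (k + 1)
      - a * b * ((k + 1) * (k + 2)) * f.coeff (k + 2) := by
  have h : legendreWeight a b * derivative f = C (a + b) * (X * derivative f)
      - C (a * b) * derivative f - X * (X * derivative f) := by
    simp only [legendreWeight, C_add, C_mul]
    ring
  rw [legendreOp, h, coeff_derivative]
  rcases k with _ | k <;>
    simp only [coeff_sub, coeff_C_mul, coeff_X_mul, coeff_X_mul_zero, coeff_derivative] <;>
    push_cast <;> ring

lemma legendreOp_mem_degreeLT (a b : ℝ) {n : ℕ} {f : ℝ[X]} (hf : f ∈ degreeLT ℝ n) :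
    legendreOp a b f ∈ degreeLT ℝ n := by
  rw [mem_degreeLT, degree_lt_iff_coeff_zero] at hf ⊢
  intro k hk
  simp [coeff_legendreOp, hf k hk, hf (k + 1) (by omega), hf (k + 2) (by omega)]

lemma legendreOp_add_mem_degreeLT (a b : ℝ) {n : ℕ} {f : ℝ[X]} (hf : f ∈ degreeLT ℝ (n + 1)) :
    legendreOp a b f + ((n : ℝ) * (n + 1)) • f ∈ degreeLT ℝ n := by
  rw [mem_degreeLT, degree_lt_iff_coeff_zero] at hf ⊢
  intro k hk
  rw [coeff_add, coeff_smul, coeff_legendreOp, hf (k + 1) (by omega), hf (k + 2) (by omega)]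
  rcases hk.eq_or_lt with rfl | hk
  · simp
  · simp [hf k hk]

lemma polyIntegral_weight_mul_derivative (a b : ℝ) (f g : ℝ[X]) :
    polyIntegral a b (legendreWeight a b * derivative f * derivative g) =
      -polyIntegral a b (legendreOp a b f * g) := by
  have h := polyIntegral_derivative a b (legendreWeight a b * derivative f * g)
  rw [derivative_mul, map_add] at h
  simp only [eval_mul, legendreWeight, eval_sub, eval_X, eval_C, sub_self, zero_mul,
    mul_zero] at h
  rw [legendreOp, legendreWeight]
  linarith

/-- Existence of the `L²(a, b)`-orthogonal projection onto polynomials of degree less than `n`. -/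
lemma exists_orthogonal_projection {a b : ℝ} (hab : a < b) (n : ℕ) (f : ℝ[X]) :
    ∃ q ∈ degreeLT ℝ n, ∀ r ∈ degreeLT ℝ n, polyIntegral a b ((f - q) * r) = 0 := by
  induction n generalizing f with
  | zero =>
    refine ⟨0, Submodule.zero_mem _, fun r hr => ?_⟩
    have hr0 : r = 0 := by
      rw [mem_degreeLT, degree_lt_iff_coeff_zero] at hr
      ext k
      simpa using hr k (Nat.zero_le k)
    simp [hr0]
  | succ n ih =>
    obtain ⟨s, hs, hs'⟩ := ih (X ^ n)
    obtain ⟨q, hq, hq'⟩ := ih f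
    have hmono : degreeLT ℝ n ≤ degreeLT ℝ (n + 1) := degreeLT_mono n.le_succ
    set P : ℝ[X] := X ^ n - s with hP
    have hXn : (X ^ n : ℝ[X]) ∈ degreeLT ℝ (n + 1) := by
      rw [mem_degreeLT, degree_X_pow]
      exact_mod_cast n.lt_succ_self
    have hPmem : P ∈ degreeLT ℝ (n + 1) := Submodule.sub_mem _ hXn (hmono hs)
    have hPcoeff : P.coeff n = 1 := by
      rw [mem_degreeLT, degree_lt_iff_coeff_zero] at hs
      simp [hP, hs n le_rfl]
    have hP0 : P ≠ 0 := fun h => by simp [h] at hPcoeff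
    have hpos := polyIntegral_sq_pos hab hP0
    set c := polyIntegral a b ((f - q) * P) / polyIntegral a b (P * P) with hc
    refine ⟨q + c • P, Submodule.add_mem _ (hmono hq) (Submodule.smul_mem _ _ hPmem),
      fun r hr => ?_⟩
    have hrt : r - r.coeff n • P ∈ degreeLT ℝ n := by
      rw [mem_degreeLT, degree_lt_iff_coeff_zero] at hr hPmem ⊢
      intro k hk
      rcases hk.eq_or_lt with rfl | hk
      · simp [hPcoeff]
      · simp [hr k hk, hPmem k hk]
    have h1 := hq' _ hrt
    have h2 := hs' _ hrt
    have h3 : (f - (q + c • P)) * r = (f - q) * (r - r.coeff n • P)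
        - c • (P * (r - r.coeff n • P)) + r.coeff n • ((f - q) * P)
        - (r.coeff n * c) • (P * P) := by
      simp only [smul_eq_C_mul, C_mul]
      ring
    rw [h3, map_sub, map_add, map_sub, map_smul, map_smul, map_smul, h1, h2, hc]
    simp only [smul_eq_mul]
    field_simp
    ring

lemma polyIntegral_weight_nonneg {a b : ℝ} (hab : a < b) (f : ℝ[X]) :
    0 ≤ polyIntegral a b (legendreWeight a b * f * f) := by
  refine intervalIntegral.integral_nonneg hab.le fun x hx => ?_
  rw [mul_assoc, eval_mul, eval_mul]
  refine mul_nonneg ?_ (mul_self_nonneg _)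
  simpa [legendreWeight] using mul_nonneg (sub_nonneg.2 hx.1) (sub_nonneg.2 hx.2)

lemma polyIntegral_weight_le {a b : ℝ} (hab : a < b) (f : ℝ[X]) :
    polyIntegral a b (legendreWeight a b * f * f) ≤
      (b - a) ^ 2 / 4 * polyIntegral a b (f * f) := by
  rw [← smul_eq_mul ((b - a) ^ 2 / 4), ← map_smul]
  refine intervalIntegral.integral_mono_on hab.le
    ((Polynomial.continuous _).intervalIntegrable a b)
    ((Polynomial.continuous _).intervalIntegrable a b) fun x _ => ?_
  rw [mul_assoc, eval_mul, eval_smul, smul_eq_mul, eval_mul]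
  refine mul_le_mul_of_nonneg_right ?_ (mul_self_nonneg _)
  simp only [legendreWeight, eval_mul, eval_sub, eval_X, eval_C]
  nlinarith [sq_nonneg (2 * x - a - b)]

/-- Weighted approximation estimate for polynomials. -/
lemma exists_polynomial_weighted_estimate {a b : ℝ} (hab : a < b) (p n : ℕ) (f : ℝ[X])
    (hf : f ∈ degreeLT ℝ n) :
    ∃ q ∈ degreeLT ℝ (p + 1),
      ((p : ℝ) + 1) * (p + 2) * polyIntegral a b ((f - q) * (f - q)) ≤
        polyIntegral a b (legendreWeight a b * derivative f * derivative f) := by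
  induction n generalizing f with
  | zero =>
    refine ⟨f, degreeLT_mono (Nat.zero_le _) hf, ?_⟩
    simpa using polyIntegral_weight_nonneg hab (derivative f)
  | succ n ih =>
    rcases le_or_gt n p with hnp | hnp
    · refine ⟨f, degreeLT_mono (by omega) hf, ?_⟩
      simpa using polyIntegral_weight_nonneg hab (derivative f)
    obtain ⟨s, hs, hs'⟩ := exists_orthogonal_projection hab n f
    obtain ⟨q, hq, hle⟩ := ih s hs
    refine ⟨q, hq, ?_⟩
    set e := f - s with he
    have hfe : f = s + e := by rw [he]; ring
    have hemem : e ∈ degreeLT ℝ (n + 1) :=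
      Submodule.sub_mem _ hf (degreeLT_mono n.le_succ hs)
    have hsq : polyIntegral a b (e * (s - q)) = 0 :=
      hs' _ (Submodule.sub_mem _ hs (degreeLT_mono (by omega) hq))
    have hnorm : polyIntegral a b ((f - q) * (f - q)) =
        polyIntegral a b ((s - q) * (s - q)) + polyIntegral a b (e * e) := by
      have : (f - q) * (f - q) = (s - q) * (s - q) + (2 : ℝ) • (e * (s - q)) + e * e := by
        rw [hfe, smul_eq_C_mul, C_ofNat]
        ring
      rw [this, map_add, map_add, map_smul, hsq, smul_zero, add_zero]
    have hcross : polyIntegral a b (legendreWeight a b * derivative s * derivative e) = 0 := by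
      rw [polyIntegral_weight_mul_derivative, mul_comm,
        hs' _ (legendreOp_mem_degreeLT a b hs), neg_zero]
    have hdiag : polyIntegral a b (legendreWeight a b * derivative e * derivative e) =
        n * (n + 1) * polyIntegral a b (e * e) := by
      have h := hs' _ (legendreOp_add_mem_degreeLT a b hemem)
      rw [mul_add, mul_smul_comm, map_add, map_smul, smul_eq_mul] at h
      rw [polyIntegral_weight_mul_derivative, mul_comm (legendreOp a b e)]
      linarith
    have henergy : polyIntegral a b (legendreWeight a b * derivative f * derivative f) =
        polyIntegral a b (legendreWeight a b * derivative s * derivative s) +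
          n * (n + 1) * polyIntegral a b (e * e) := by
      have : legendreWeight a b * derivative f * derivative f =
          legendreWeight a b * derivative s * derivative s
          + (2 : ℝ) • (legendreWeight a b * derivative s * derivative e)
          + legendreWeight a b * derivative e * derivative e := by
        rw [hfe, derivative_add, smul_eq_C_mul, C_ofNat]
        ring
      rw [this, map_add, map_add, map_smul, hcross, hdiag, smul_zero, add_zero]
    have hee : 0 ≤ polyIntegral a b (e * e) :=
      intervalIntegral.integral_nonneg hab.le fun x _ => by
        rw [eval_mul]
        exact mul_self_nonneg _
    have hpn : (p : ℝ) + 1 ≤ n := by exact_mod_cast hnp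
    have hcoef : ((p : ℝ) + 1) * (p + 2) ≤ n * (n + 1) := by
      have : (0 : ℝ) ≤ p := p.cast_nonneg
      nlinarith
    rw [hnorm, henergy, mul_add]
    exact add_le_add hle (mul_le_mul_of_nonneg_right hcoef hee)

/-- The `L²` estimate for polynomials. -/
lemma exists_polynomial_estimate {a b : ℝ} (hab : a < b) (p : ℕ) (f : ℝ[X]) :
    ∃ q : ℝ[X], q.natDegree ≤ p ∧
      ∫ x in a..b, (f.eval x - q.eval x) ^ 2 ≤
        (b - a) ^ 2 / (4 * ((p : ℝ) + 1) ^ 2) *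
          ∫ x in a..b, ((derivative f).eval x) ^ 2 := by
  obtain ⟨q, hq, hle⟩ := exists_polynomial_weighted_estimate hab p (f.natDegree + 1) f
    (by rw [mem_degreeLT]; exact degree_lt_iff_coeff_zero _ _ |>.2 fun k hk =>
          coeff_eq_zero_of_natDegree_lt hk)
  refine ⟨q, ?_, ?_⟩
  · rw [mem_degreeLT, degree_lt_iff_coeff_zero] at hq
    exact natDegree_le_iff_coeff_eq_zero.2 fun k hk => hq k hk
  have h1 : ∫ x in a..b, (f.eval x - q.eval x) ^ 2 = polyIntegral a b ((f - q) * (f - q)) := by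
    simp [polyIntegral_apply, sq]
  have h2 : ∫ x in a..b, ((derivative f).eval x) ^ 2 =
      polyIntegral a b (derivative f * derivative f) := by
    simp [polyIntegral_apply, sq]
  have h3 := hle.trans (polyIntegral_weight_le hab (derivative f))
  have h0 : 0 ≤ ∫ x in a..b, (f.eval x - q.eval x) ^ 2 :=
    intervalIntegral.integral_nonneg hab.le fun x _ => sq_nonneg _
  rw [← h1, ← h2] at h3
  have hp : (0 : ℝ) ≤ p := p.cast_nonneg
  rw [div_mul_eq_mul_div, le_div_iff₀ (by positivity)]
  nlinarith [mul_nonneg hp h0]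

lemma derivative_surjective_real : Function.Surjective (derivative : ℝ[X] → ℝ[X]) := by
  intro R
  induction R using Polynomial.induction_on' with
  | add f g hf hg =>
    obtain ⟨F, rfl⟩ := hf
    obtain ⟨G, rfl⟩ := hg
    exact ⟨F + G, derivative_add⟩
  | monomial n c =>
    refine ⟨monomial (n + 1) (c / (n + 1)), ?_⟩
    rw [derivative_monomial, Nat.add_sub_cancel]
    congr 1
    push_cast
    exact div_mul_cancel₀ c n.cast_add_one_ne_zero

/-- Simultaneous uniform approximation of a `C¹` function and its derivative by a polynomial. -/
lemma exists_polynomial_near_deriv {a b : ℝ} (hab : a < b) {u : ℝ → ℝ}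
    (hu : ContDiffOn ℝ 1 u (Set.Icc a b)) {ε : ℝ} (hε : 0 < ε) :
    ∃ Q : ℝ[X], ∀ x ∈ Set.Icc a b, |u x - Q.eval x| ≤ ε * (b - a) ∧
      |derivWithin u (Set.Icc a b) x - (derivative Q).eval x| ≤ ε := by
  have hg : ContinuousOn (derivWithin u (Set.Icc a b)) (Set.Icc a b) :=
    hu.continuousOn_derivWithin (uniqueDiffOn_Icc hab) le_rfl
  obtain ⟨R, hR⟩ := exists_polynomial_near_of_continuousOn a b _ hg ε hε
  obtain ⟨S, hS⟩ := derivative_surjective_real R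
  refine ⟨S + C (u a - S.eval a), ?_⟩
  have hd : ∀ x ∈ Set.Icc a b, |derivWithin u (Set.Icc a b) x
      - (derivative (S + C (u a - S.eval a))).eval x| ≤ ε := fun x hx => by
    rw [derivative_add, derivative_C, add_zero, hS, abs_sub_comm]
    exact (hR x hx).le
  refine fun x hx => ⟨?_, hd x hx⟩
  set Q := S + C (u a - S.eval a) with hQ
  have hder : ∀ y ∈ Set.Icc a b, HasDerivWithinAt (fun z => u z - Q.eval z)
      (derivWithin u (Set.Icc a b) y - (derivative Q).eval y) (Set.Icc a b) y := fun y hy =>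
    ((hu.differentiableOn one_ne_zero y hy).hasDerivWithinAt).sub (Q.hasDerivAt y).hasDerivWithinAt
  have h := (convex_Icc a b).norm_image_sub_le_of_norm_hasDerivWithin_le hder
    (fun y hy => hd y hy) (Set.left_mem_Icc.2 hab.le) hx
  have hQa : u a - Q.eval a = 0 := by simp [hQ]
  rw [hQa, sub_zero, Real.norm_eq_abs, Real.norm_eq_abs, abs_of_nonneg (sub_nonneg.2 hx.1)] at h
  exact h.trans (mul_le_mul_of_nonneg_left (by linarith [hx.2]) hε.le)

/-- If `f` is within `δ` of `g` on `[a, b]`, then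
`∫ (f - k)² ≤ 2 δ² (b - a) + 2 ∫ (g - k)²`. -/
lemma integral_sq_sub_le {a b δ : ℝ} (hab : a < b) {f g k : ℝ → ℝ}
    (hf : ContinuousOn f (Set.Icc a b)) (hg : ContinuousOn g (Set.Icc a b))
    (hk : ContinuousOn k (Set.Icc a b)) (h : ∀ x ∈ Set.Icc a b, |f x - g x| ≤ δ) :
    ∫ x in a..b, (f x - k x) ^ 2 ≤
      2 * δ ^ 2 * (b - a) + 2 * ∫ x in a..b, (g x - k x) ^ 2 := by
  have hgk : IntervalIntegrable (fun x => 2 * (g x - k x) ^ 2) MeasureTheory.volume a b :=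
    (((hg.sub hk).pow 2).const_mul 2).intervalIntegrable_of_Icc hab.le
  have hc : IntervalIntegrable (fun _ : ℝ => 2 * δ ^ 2) MeasureTheory.volume a b :=
    intervalIntegrable_const
  calc ∫ x in a..b, (f x - k x) ^ 2
      ≤ ∫ x in a..b, (2 * δ ^ 2 + 2 * (g x - k x) ^ 2) := by
        refine intervalIntegral.integral_mono_on hab.le
          (((hf.sub hk).pow 2).intervalIntegrable_of_Icc hab.le) (hc.add hgk) fun x hx => ?_
        have h1 : (f x - g x) ^ 2 ≤ δ ^ 2 := sq_le_sq' (abs_le.1 (h x hx)).1 (abs_le.1 (h x hx)).2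
        nlinarith [sq_nonneg (f x - g x - (g x - k x))]
    _ = 2 * δ ^ 2 * (b - a) + 2 * ∫ x in a..b, (g x - k x) ^ 2 := by
        rw [intervalIntegral.integral_add hc hgk, intervalIntegral.integral_const,
          intervalIntegral.integral_const_mul, smul_eq_mul, mul_comm (b - a)]

/-- Scaled one-dimensional hp-approximation estimate: there is a constant
`C > 0`, independent of `p`, `u`, `a`, `b`, such that for every interval
`(a, b)` and every `u` continuously differentiable on `[a, b]`, some polynomial
`q` of degree at most `p` satisfies
`‖u - q‖_{L²(a,b)} ≤ (C (b-a)/(p+1)) ‖u'‖_{L²(a,b)}`. -/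
theorem hp_approximation_scaled :
    ∃ C : ℝ, 0 < C ∧ ∀ (p : ℕ) (a b : ℝ), a < b → ∀ u : ℝ → ℝ,
      ContDiffOn ℝ 1 u (Set.Icc a b) →
      ∃ q : Polynomial ℝ, q.natDegree ≤ p ∧
        Real.sqrt (∫ x in a..b, (u x - q.eval x) ^ 2) ≤
          C * (b - a) / ((p : ℝ) + 1) *
            Real.sqrt (∫ x in a..b, (derivWithin u (Set.Icc a b) x) ^ 2) := by
  refine ⟨2, two_pos, fun p a b hab u hu => ?_⟩
  have hg : ContinuousOn (derivWithin u (Set.Icc a b)) (Set.Icc a b) :=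
    hu.continuousOn_derivWithin (uniqueDiffOn_Icc hab) le_rfl
  have hh : 0 < b - a := sub_pos.2 hab
  set M := ∫ x in a..b, (derivWithin u (Set.Icc a b) x) ^ 2 with hM
  have hM0 : 0 ≤ M := intervalIntegral.integral_nonneg hab.le fun x _ => sq_nonneg _
  suffices h : ∃ q : ℝ[X], q.natDegree ≤ p ∧
      ∫ x in a..b, (u x - q.eval x) ^ 2 ≤ (2 * (b - a) / ((p : ℝ) + 1)) ^ 2 * M by
    obtain ⟨q, hq, hle⟩ := h
    refine ⟨q, hq, (Real.sqrt_le_sqrt hle).trans_eq ?_⟩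
    rw [Real.sqrt_mul (sq_nonneg _), Real.sqrt_sq (by positivity)]
  rcases hM0.eq_or_lt with hM0 | hM0
  · have hzero : ∀ x ∈ Set.Icc a b, derivWithin u (Set.Icc a b) x = 0 := by
      intro x hx
      by_contra hne
      exact (intervalIntegral.integral_pos hab (hg.pow 2) (fun x _ => sq_nonneg _)
        ⟨x, hx, sq_pos_of_ne_zero hne⟩).ne hM0
    have hconst := constant_of_derivWithin_zero (hu.differentiableOn one_ne_zero)
      fun x hx => hzero x (Set.Ico_subset_Icc_self hx)
    refine ⟨C (u a), by simp, ?_⟩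
    have : ∫ x in a..b, (u x - (C (u a)).eval x) ^ 2 = ∫ x in a..b, (0 : ℝ) := by
      refine intervalIntegral.integral_congr fun x hx => ?_
      rw [Set.uIcc_of_le hab.le] at hx
      simp [hconst x hx]
    rw [this, ← hM0]
    simp
  · have hp : (0 : ℝ) < (p : ℝ) + 1 := by positivity
    set ε := Real.sqrt (M / (3 * (b - a) * ((p : ℝ) + 1) ^ 2)) with hεdef
    have hε : 0 < ε := Real.sqrt_pos.2 (by positivity)
    have hε2 : ε ^ 2 * (b - a) * ((p : ℝ) + 1) ^ 2 = M / 3 := by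
      rw [hεdef, Real.sq_sqrt (by positivity)]
      field_simp
    obtain ⟨Q, hQ⟩ := exists_polynomial_near_deriv hab hu hε
    obtain ⟨q, hq, hle⟩ := exists_polynomial_estimate hab p Q
    refine ⟨q, hq, ?_⟩
    have h1 := integral_sq_sub_le hab hu.continuousOn Q.continuous.continuousOn
      q.continuous.continuousOn fun x hx => (hQ x hx).1
    have h2 := integral_sq_sub_le hab (derivative Q).continuous.continuousOn hg
      (continuousOn_const (c := (0 : ℝ))) fun x hx => by
        rw [abs_sub_comm]
        exact (hQ x hx).2
    simp only [sub_zero] at h2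
    rw [← hM] at h2
    have hε1 : ε ^ 2 * (b - a) ≤ M / 3 := by
      rw [← hε2]
      refine le_mul_of_one_le_right (by positivity) (one_le_pow₀ ?_)
      linarith [(p.cast_nonneg : (0 : ℝ) ≤ p)]
    have h3 : ∫ x in a..b, (Q.eval x - q.eval x) ^ 2 ≤
        (b - a) ^ 2 / (4 * ((p : ℝ) + 1) ^ 2) * (3 * M) :=
      hle.trans (mul_le_mul_of_nonneg_left (by linarith) (by positivity))
    have h4 : 2 * (ε * (b - a)) ^ 2 * (b - a) = (b - a) ^ 2 / ((p : ℝ) + 1) ^ 2 * (2 / 3 * M) := by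
      field_simp
      linear_combination 3 * hε2
    calc _ ≤ _ := h1
      _ ≤ (b - a) ^ 2 / ((p : ℝ) + 1) ^ 2 * (2 / 3 * M)
          + 2 * ((b - a) ^ 2 / (4 * ((p : ℝ) + 1) ^ 2) * (3 * M)) := by linarith
      _ = (b - a) ^ 2 / ((p : ℝ) + 1) ^ 2 * M * (13 / 6) := by
        field_simp
        ring
      _ ≤ (b - a) ^ 2 / ((p : ℝ) + 1) ^ 2 * M * 4 := by gcongr; norm_num
      _ = _ := by
        field_simp
        ring
end
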